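/- arXiv:2206.00575 — 5 statements merged into one kernel-verified Lean document; each statement's English description precedes it below -/
import Mathlib

section
/- Let ζ ∈ ℂ be a primitive m-th root of unity and let σ be the ℂ-algebra automorphism of the polynomial ring ℂ[x,y] determined by σ(x) = ζ·x and σ(y) = ζ^{m−1}·y. Then a polynomial f ∈ ℂ[x,y] satisfies σ(f) = f if and only if f lies in the ℂ-subalgebra of ℂ[x,y] generated by x^m, y^m, and x·y. -/
open MvPolynomial

lemma aux_monomial (d : Fin 2 →₀ ℕ) (c : ℂ) :
    (monomial d c : MvPolynomial (Fin 2) ℂ) = C c * (X 0 ^ d 0 * X 1 ^ d 1) := by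
  rw [monomial_eq, Finsupp.prod_fintype _ _ (by simp), Fin.prod_univ_two]

lemma aux_coeff (m : ℕ) (ζ : ℂ)
    (σ : MvPolynomial (Fin 2) ℂ →ₐ[ℂ] MvPolynomial (Fin 2) ℂ)
    (hσx : σ (X 0) = C ζ * X 0) (hσy : σ (X 1) = C (ζ ^ (m - 1)) * X 1)
    (f : MvPolynomial (Fin 2) ℂ) (d : Fin 2 →₀ ℕ) :
    coeff d (σ f) = ζ ^ (d 0 + (m - 1) * d 1) * coeff d f := by
  induction f using MvPolynomial.induction_on' with
  | monomial e c =>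
    have h : σ (monomial e c) = monomial e (ζ ^ (e 0 + (m - 1) * e 1) * c) := by
      have hC : σ (C c) = C c := σ.commutes c
      rw [aux_monomial, aux_monomial, map_mul, map_mul, map_pow, map_pow, hσx, hσy, hC]
      simp only [map_mul, map_pow, pow_add, pow_mul, mul_pow]
      ring
    rw [h, coeff_monomial, coeff_monomial]
    split_ifs with h1
    · rw [h1]
    · simp
  | add p q hp hq => rw [map_add, coeff_add, coeff_add, hp, hq, mul_add]

theorem stmt_2 (m : ℕ) (hm : 0 < m) (ζ : ℂ) (hζ : IsPrimitiveRoot ζ m)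
    (σ : MvPolynomial (Fin 2) ℂ →ₐ[ℂ] MvPolynomial (Fin 2) ℂ)
    (hσx : σ (X 0) = C ζ * X 0) (hσy : σ (X 1) = C (ζ ^ (m - 1)) * X 1)
    (f : MvPolynomial (Fin 2) ℂ) :
    σ f = f ↔
      f ∈ Algebra.adjoin ℂ
        ({X 0 ^ m, X 1 ^ m, X 0 * X 1} : Set (MvPolynomial (Fin 2) ℂ)) := by
  constructor
  · intro hf
    set A := Algebra.adjoin ℂ
        ({X 0 ^ m, X 1 ^ m, X 0 * X 1} : Set (MvPolynomial (Fin 2) ℂ)) with hA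
    have hx : (X 0 ^ m : MvPolynomial (Fin 2) ℂ) ∈ A := Algebra.subset_adjoin (by simp)
    have hy : (X 1 ^ m : MvPolynomial (Fin 2) ℂ) ∈ A := Algebra.subset_adjoin (by simp)
    have hxy : (X 0 * X 1 : MvPolynomial (Fin 2) ℂ) ∈ A := Algebra.subset_adjoin (by simp)
    rw [f.as_sum]
    refine sum_mem fun d hd => ?_
    have hc : coeff d f ≠ 0 := mem_support_iff.mp hd
    have h := aux_coeff m ζ σ hσx hσy f d
    rw [hf] at h
    have h1 : ζ ^ (d 0 + (m - 1) * d 1) = 1 :=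
      mul_right_cancel₀ hc (by rw [← h, one_mul])
    have h2 := hζ.dvd_of_pow_eq_one _ h1
    rw [aux_monomial]
    refine mul_mem (A.algebraMap_mem _) ?_
    obtain ⟨n, rfl⟩ : ∃ n, m = n + 1 := ⟨m - 1, by omega⟩
    rw [Nat.add_sub_cancel] at h2
    rcases le_total (d 0) (d 1) with hle | hle
    · obtain ⟨k, hk⟩ := Nat.exists_eq_add_of_le hle
      rw [hk] at h2 ⊢
      have h3 : n + 1 ∣ n * k := by
        rw [show d 0 + n * (d 0 + k) = (n + 1) * d 0 + n * k by ring] at h2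
        exact (Nat.dvd_add_right (dvd_mul_right _ _)).mp h2
      have h4 : n + 1 ∣ k := Nat.Coprime.dvd_of_dvd_mul_left (by simp) h3
      obtain ⟨j, rfl⟩ := h4
      rw [pow_add, ← mul_assoc, ← mul_pow, pow_mul]
      exact mul_mem (pow_mem hxy _) (pow_mem hy _)
    · obtain ⟨k, hk⟩ := Nat.exists_eq_add_of_le hle
      rw [hk] at h2 ⊢
      have h4 : n + 1 ∣ k := by
        rw [show d 1 + k + n * d 1 = (n + 1) * d 1 + k by ring] at h2
        exact (Nat.dvd_add_right (dvd_mul_right _ _)).mp h2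
      obtain ⟨j, rfl⟩ := h4
      rw [pow_add, mul_right_comm, ← mul_pow, pow_mul]
      exact mul_mem (pow_mem hxy _) (pow_mem hx _)
  · intro hf
    have hle : Algebra.adjoin ℂ
        ({X 0 ^ m, X 1 ^ m, X 0 * X 1} : Set (MvPolynomial (Fin 2) ℂ)) ≤
        AlgHom.equalizer σ (AlgHom.id ℂ _) := by
      refine Algebra.adjoin_le ?_
      rintro p (rfl | rfl | rfl)
      · change σ _ = _
        rw [map_pow, hσx, mul_pow, ← C_pow, hζ.pow_eq_one]
        simp
      · change σ _ = _
        rw [map_pow, hσy, mul_pow, ← C_pow, ← pow_mul, mul_comm (m - 1), pow_mul,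
          hζ.pow_eq_one]
        simp
      · change σ _ = _
        have hz : ζ * ζ ^ (m - 1) = 1 := by
          rw [← pow_succ', Nat.sub_add_cancel hm, hζ.pow_eq_one]
        rw [map_mul, hσx, hσy, mul_mul_mul_comm, ← C_mul, hz]
        simp
    exact hle hf
end

section
/- The kernel of the ℂ-algebra homomorphism ℂ[u,v,w] → ℂ[x,y] determined by u ↦ x^m, v ↦ y^m, w ↦ x·y equals the principal ideal of ℂ[u,v,w] generated by u·v − w^m. -/
open MvPolynomial

/-- A linear section of the parametrization on monomials. -/
noncomputable def secMap (m : ℕ) : MvPolynomial (Fin 2) ℂ →ₗ[ℂ] MvPolynomial (Fin 3) ℂ :=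
  (basisMonomials (Fin 2) ℂ).constr ℂ (fun e =>
    X 0 ^ ((e 0 - min (e 0) (e 1)) / m) * X 1 ^ ((e 1 - min (e 0) (e 1)) / m)
      * X 2 ^ (min (e 0) (e 1)))

lemma secMap_apply (m p q : ℕ) : secMap m (X 0 ^ p * X 1 ^ q) =
    X 0 ^ ((p - min p q) / m) * X 1 ^ ((q - min p q) / m) * X 2 ^ (min p q) := by
  have h : (X 0 ^ p * X 1 ^ q : MvPolynomial (Fin 2) ℂ) =
      basisMonomials (Fin 2) ℂ (Finsupp.single 0 p + Finsupp.single 1 q) := by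
    simp [X_pow_eq_monomial, monomial_mul]
  rw [h, secMap, Module.Basis.constr_basis]
  simp

lemma key_eq {R : Type*} [CommRing R] (m a b c : ℕ) (hm : 0 < m) (u v w : R)
    (h : u * v = w ^ m) :
    u ^ ((m * a + c - min (m * a + c) (m * b + c)) / m) *
      v ^ ((m * b + c - min (m * a + c) (m * b + c)) / m) * w ^ (min (m * a + c) (m * b + c))
      = u ^ a * v ^ b * w ^ c := by
  rcases le_total a b with hab | hab
  · obtain ⟨d, rfl⟩ := Nat.exists_eq_add_of_le hab
    have h1 : min (m * a + c) (m * (a + d) + c) = m * a + c := by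
      rw [mul_add]; omega
    have h2 : m * (a + d) + c - (m * a + c) = m * d := by rw [mul_add]; omega
    rw [h1, h2, Nat.sub_self, Nat.zero_div, Nat.mul_div_cancel_left _ hm, pow_add, pow_mul, ← h]
    ring
  · obtain ⟨d, rfl⟩ := Nat.exists_eq_add_of_le hab
    have h1 : min (m * (b + d) + c) (m * b + c) = m * b + c := by
      rw [mul_add]; omega
    have h2 : m * (b + d) + c - (m * b + c) = m * d := by rw [mul_add]; omega
    rw [h1, h2, Nat.sub_self, Nat.zero_div, Nat.mul_div_cancel_left _ hm, pow_add w, pow_mul, ← h]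
    ring

/-- The kernel of the `ℂ`-algebra homomorphism `ℂ[u,v,w] → ℂ[x,y]` determined by
`u ↦ x^m`, `v ↦ y^m`, `w ↦ x*y` equals the principal ideal generated by `u*v - w^m`. -/
theorem stmt_3 (m : ℕ) (hm : 0 < m) :
    RingHom.ker (MvPolynomial.aeval
        (![X 0 ^ m, X 1 ^ m, X 0 * X 1] : Fin 3 → MvPolynomial (Fin 2) ℂ) :
        MvPolynomial (Fin 3) ℂ →ₐ[ℂ] MvPolynomial (Fin 2) ℂ) =
      Ideal.span {X 0 * X 1 - X 2 ^ m} := by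
  set φ : MvPolynomial (Fin 3) ℂ →ₐ[ℂ] MvPolynomial (Fin 2) ℂ := MvPolynomial.aeval
        (![X 0 ^ m, X 1 ^ m, X 0 * X 1] : Fin 3 → MvPolynomial (Fin 2) ℂ) with hφ
  set I : Ideal (MvPolynomial (Fin 3) ℂ) := Ideal.span {X 0 * X 1 - X 2 ^ m} with hI
  apply le_antisymm
  · have hrel : Ideal.Quotient.mk I (X 0) * Ideal.Quotient.mk I (X 1) =
        Ideal.Quotient.mk I (X 2) ^ m := by
      rw [← map_mul, ← map_pow, Ideal.Quotient.eq]
      exact Ideal.subset_span rfl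
    have hL : (Ideal.Quotient.mkₐ ℂ I).toLinearMap ∘ₗ secMap m ∘ₗ φ.toLinearMap =
        (Ideal.Quotient.mkₐ ℂ I).toLinearMap := by
      apply (basisMonomials (Fin 3) ℂ).ext
      intro e
      have he : basisMonomials (Fin 3) ℂ e = X 0 ^ e 0 * X 1 ^ e 1 * X 2 ^ e 2 := by
        rw [coe_basisMonomials]
        beta_reduce
        rw [monomial_eq, Finsupp.prod_fintype _ _ (by simp),
          Fin.prod_univ_three]
        simp
      have hφe : φ (X 0 ^ e 0 * X 1 ^ e 1 * X 2 ^ e 2) =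
          X 0 ^ (m * e 0 + e 2) * X 1 ^ (m * e 1 + e 2) := by
        simp [hφ]
        ring
      rw [he]
      simp only [LinearMap.comp_apply, AlgHom.toLinearMap_apply]
      rw [hφe, secMap_apply]
      simp only [Ideal.Quotient.mkₐ_eq_mk, map_mul, map_pow]
      exact key_eq m _ _ _ hm _ _ _ hrel
    intro f hf
    rw [RingHom.mem_ker] at hf
    have := LinearMap.congr_fun hL f
    simp only [LinearMap.comp_apply, AlgHom.toLinearMap_apply] at this
    rw [hf, map_zero, map_zero] at this
    exact Ideal.Quotient.eq_zero_iff_mem.mp this.symm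
  · rw [hI, Ideal.span_le, Set.singleton_subset_iff]
    simp [hφ, RingHom.mem_ker, mul_pow]
end

section
/- Let a, d, b be positive integers and c an integer with a·d − b·c = 1. Let α, β, γ, δ be natural numbers with α + β = 2a, γ + δ = 2d, and α ≡ β ≡ γ ≡ δ ≡ c (mod 2). Let V = {(x,y,u,v) ∈ ℂ⁴ : x² + y² = u^α·v^β and u² + v² = x^γ·y^δ}. Then each of the four linear maps A₁: (x,y,u,v) ↦ (−ζ^a x, ζ^a y, ζu, ζv), A₂: (x,y,u,v) ↦ (ζ^a x, −ζ^a y, ζu, ζv), A₃: (x,y,u,v) ↦ (ζx, ζy, −ζ^d u, ζ^d v), A₄: (x,y,u,v) ↦ (ζx, ζy, ζ^d u, −ζ^d v) maps V into V. -/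
/-- Neumann–Wahl local model of the universal abelian cover of a quotient-cusp:
the four linear maps `A₁, …, A₄` map the locus
`V = {x² + y² = u^α v^β, u² + v² = x^γ y^δ}` into itself. -/
theorem stmt_5 (a d b : ℕ) (ha : 0 < a) (hd : 0 < d) (hb : 0 < b)
    (c : ℤ) (hdet : (a : ℤ) * d - (b : ℤ) * c = 1)
    (ζ : ℂ) (hζ : IsPrimitiveRoot ζ (4 * b))
    (α β γ δ : ℕ) (hαβ : α + β = 2 * a) (hγδ : γ + δ = 2 * d)
    (hα : (α : ℤ) % 2 = c % 2) (hβ : (β : ℤ) % 2 = c % 2)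
    (hγ : (γ : ℤ) % 2 = c % 2) (hδ : (δ : ℤ) % 2 = c % 2)
    (V : Set (ℂ × ℂ × ℂ × ℂ))
    (hV : V = {p : ℂ × ℂ × ℂ × ℂ |
      p.1 ^ 2 + p.2.1 ^ 2 = p.2.2.1 ^ α * p.2.2.2 ^ β ∧
      p.2.2.1 ^ 2 + p.2.2.2 ^ 2 = p.1 ^ γ * p.2.1 ^ δ}) :
    (∀ p ∈ V, (-(ζ ^ a) * p.1, ζ ^ a * p.2.1, ζ * p.2.2.1, ζ * p.2.2.2) ∈ V) ∧
    (∀ p ∈ V, (ζ ^ a * p.1, -(ζ ^ a) * p.2.1, ζ * p.2.2.1, ζ * p.2.2.2) ∈ V) ∧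
    (∀ p ∈ V, (ζ * p.1, ζ * p.2.1, -(ζ ^ d) * p.2.2.1, ζ ^ d * p.2.2.2) ∈ V) ∧
    (∀ p ∈ V, (ζ * p.1, ζ * p.2.1, ζ ^ d * p.2.2.1, -(ζ ^ d) * p.2.2.2) ∈ V) := by
  have h0 : ζ ≠ 0 := hζ.ne_zero (by omega)
  have h2b : ζ ^ (2 * b) = -1 := by
    have h1 : ζ ^ (2 * b) * ζ ^ (2 * b) = 1 := by
      rw [← pow_add, ← hζ.pow_eq_one]; congr 1; ring
    rcases mul_self_eq_one_iff.mp h1 with h | h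
    · exact absurd h (hζ.pow_ne_one_of_pos_of_lt (by omega) (by omega))
    · exact h
  have hz : ζ ^ (2 * (a * d)) = ζ ^ 2 * (-1 : ℂ) ^ c := by
    rw [← h2b, ← zpow_natCast, ← zpow_natCast, ← zpow_natCast, ← zpow_mul, ← zpow_add₀ h0]
    congr 1
    push_cast
    linear_combination 2 * hdet
  have key : ∀ n : ℕ, (n : ℤ) % 2 = c % 2 → (-1 : ℂ) ^ n * ζ ^ (2 * (a * d)) = ζ ^ 2 := by
    intro n hn
    rw [hz]
    rcases Int.even_or_odd c with h | h
    · have hn' : Even n := by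
        rw [Int.even_iff] at h; rw [Nat.even_iff]; omega
      rw [h.neg_one_zpow, hn'.neg_one_pow]; ring
    · have hn' : Odd n := by
        rw [Int.odd_iff] at h; rw [Nat.odd_iff]; omega
      rw [h.neg_one_zpow, hn'.neg_one_pow]; ring
  have e1 : ζ ^ α * ζ ^ β = (ζ ^ a) ^ 2 := by
    rw [← pow_add, hαβ, ← pow_mul, mul_comm]
  have e2 : ζ ^ γ * ζ ^ δ = (ζ ^ d) ^ 2 := by
    rw [← pow_add, hγδ, ← pow_mul, mul_comm]
  have e3 : (ζ ^ a) ^ γ * (ζ ^ a) ^ δ = ζ ^ (2 * (a * d)) := by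
    rw [← pow_add, hγδ, ← pow_mul]; congr 1; ring
  have e4 : (ζ ^ d) ^ α * (ζ ^ d) ^ β = ζ ^ (2 * (a * d)) := by
    rw [← pow_add, hαβ, ← pow_mul]; congr 1; ring
  subst hV
  refine ⟨?_, ?_, ?_, ?_⟩ <;> rintro ⟨x, y, u, v⟩ ⟨h1, h2⟩ <;>
    simp only at h1 h2 <;> refine ⟨?_, ?_⟩ <;>
    simp only [mul_pow, neg_pow (ζ ^ a), neg_pow (ζ ^ d)]
  · linear_combination (ζ ^ a) ^ 2 * h1 - u ^ α * v ^ β * e1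
  · linear_combination ζ ^ 2 * h2 - x ^ γ * y ^ δ * ((-1) ^ γ * e3 + key γ hγ)
  · linear_combination (ζ ^ a) ^ 2 * h1 - u ^ α * v ^ β * e1
  · linear_combination ζ ^ 2 * h2 - x ^ γ * y ^ δ * ((-1) ^ δ * e3 + key δ hδ)
  · linear_combination ζ ^ 2 * h1 - u ^ α * v ^ β * ((-1) ^ α * e4 + key α hα)
  · linear_combination (ζ ^ d) ^ 2 * h2 - x ^ γ * y ^ δ * e2
  · linear_combination ζ ^ 2 * h1 - u ^ α * v ^ β * ((-1) ^ β * e4 + key β hβ)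
  · linear_combination (ζ ^ d) ^ 2 * h2 - x ^ γ * y ^ δ * e2
end

section
/- A homogeneous polynomial f ∈ ℂ[x₁,y₁,x₂,y₂] of degree 6 satisfies σ₁(f) = σ₂(f) = σ₃(f) = f if and only if there exist complex numbers α, β, A, B such that f = α·(x₁⁶ + x₂⁶) + β·(y₁⁶ + y₂⁶) + A·Q₊³ + B·Q₊·Q₋². Moreover, the quadruple (α, β, A, B) is uniquely determined by f. -/
open MvPolynomial

/-- `sexticForm α β A B = α·(x₁⁶ + x₂⁶) + β·(y₁⁶ + y₂⁶) + A·Q₊³ + B·Q₊·Q₋²`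
in `ℂ[x₁,y₁,x₂,y₂]` with `x₁ = X 0, y₁ = X 1, x₂ = X 2, y₂ = X 3`,
`Q₊ = x₁y₁ + x₂y₂`, `Q₋ = x₁y₁ - x₂y₂`. -/
noncomputable def sexticForm (α β A B : ℂ) : MvPolynomial (Fin 4) ℂ :=
  C α * (X 0 ^ 6 + X 2 ^ 6) + C β * (X 1 ^ 6 + X 3 ^ 6) +
    C A * (X 0 * X 1 + X 2 * X 3) ^ 3 +
    C B * ((X 0 * X 1 + X 2 * X 3) * (X 0 * X 1 - X 2 * X 3) ^ 2)

/-- The exponent vector `(a, b, c, d)`. -/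
noncomputable def expo (a b c d : ℕ) : Fin 4 →₀ ℕ :=
  Finsupp.equivFunOnFinite.symm ![a, b, c, d]

lemma expo_self (m : Fin 4 →₀ ℕ) : m = expo (m 0) (m 1) (m 2) (m 3) := by
  ext i
  fin_cases i <;> simp [expo]

lemma expo_inj (a b c d a' b' c' d' : ℕ) :
    expo a b c d = expo a' b' c' d' ↔ a = a' ∧ b = b' ∧ c = c' ∧ d = d' := by
  constructor
  · intro h
    have h0 := DFunLike.congr_fun h 0
    have h1 := DFunLike.congr_fun h 1
    have h2 := DFunLike.congr_fun h 2
    have h3 := DFunLike.congr_fun h 3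
    simp [expo] at h0 h1 h2 h3
    exact ⟨h0, h1, h2, h3⟩
  · rintro ⟨rfl, rfl, rfl, rfl⟩
    rfl

lemma monomial_expo (a b c d : ℕ) (r : ℂ) :
    monomial (expo a b c d) r = C r * (X 0 ^ a * X 1 ^ b * X 2 ^ c * X 3 ^ d) := by
  rw [monomial_eq, Finsupp.prod_fintype _ _ (by simp)]
  simp [Fin.prod_univ_four, expo]

lemma sexticForm_eq (α β A B : ℂ) : sexticForm α β A B =
    monomial (expo 6 0 0 0) α + monomial (expo 0 0 6 0) α +
    monomial (expo 0 6 0 0) β + monomial (expo 0 0 0 6) β +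
    monomial (expo 3 3 0 0) (A + B) + monomial (expo 0 0 3 3) (A + B) +
    monomial (expo 2 2 1 1) (3 * A - B) + monomial (expo 1 1 2 2) (3 * A - B) := by
  have h3 : (C (3 : ℂ) : MvPolynomial (Fin 4) ℂ) = 3 := map_ofNat C 3
  simp only [monomial_expo, sexticForm, C_add, C_sub, C_mul, h3]
  ring

lemma coeff_sexticForm (α β A B : ℂ) (a b c d : ℕ) :
    coeff (expo a b c d) (sexticForm α β A B) =
    (if 6 = a ∧ 0 = b ∧ 0 = c ∧ 0 = d then α else 0) +
    (if 0 = a ∧ 0 = b ∧ 6 = c ∧ 0 = d then α else 0) +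
    (if 0 = a ∧ 6 = b ∧ 0 = c ∧ 0 = d then β else 0) +
    (if 0 = a ∧ 0 = b ∧ 0 = c ∧ 6 = d then β else 0) +
    (if 3 = a ∧ 3 = b ∧ 0 = c ∧ 0 = d then A + B else 0) +
    (if 0 = a ∧ 0 = b ∧ 3 = c ∧ 3 = d then A + B else 0) +
    (if 2 = a ∧ 2 = b ∧ 1 = c ∧ 1 = d then 3 * A - B else 0) +
    (if 1 = a ∧ 1 = b ∧ 2 = c ∧ 2 = d then 3 * A - B else 0) := by
  classical
  rw [sexticForm_eq]
  simp only [coeff_add, coeff_monomial, expo_inj]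

lemma coeff_diag (σ : MvPolynomial (Fin 4) ℂ →ₐ[ℂ] MvPolynomial (Fin 4) ℂ) (w : Fin 4 → ℂ)
    (h : ∀ i, σ (X i) = C (w i) * X i) (f : MvPolynomial (Fin 4) ℂ) (a b c d : ℕ) :
    coeff (expo a b c d) (σ f) =
      w 0 ^ a * w 1 ^ b * w 2 ^ c * w 3 ^ d * coeff (expo a b c d) f := by
  classical
  induction f using MvPolynomial.induction_on' with
  | monomial u r =>
    have : σ (monomial u r) =
        monomial u (w 0 ^ u 0 * w 1 ^ u 1 * w 2 ^ u 2 * w 3 ^ u 3 * r) := by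
      rw [expo_self u, monomial_expo, monomial_expo]
      simp only [map_mul, map_pow, h, algHom_C, algebraMap_eq, ← expo_self]
      ring
    rw [this, coeff_monomial, coeff_monomial]
    split_ifs with hu
    · subst hu
      simp [expo]
    · simp
  | add p q hp hq =>
    simp only [map_add, coeff_add, hp, hq]
    ring

lemma coeff_swap (σ : MvPolynomial (Fin 4) ℂ →ₐ[ℂ] MvPolynomial (Fin 4) ℂ)
    (h0 : σ (X 0) = X 2) (h1 : σ (X 1) = X 3) (h2 : σ (X 2) = X 0) (h3 : σ (X 3) = X 1)
    (f : MvPolynomial (Fin 4) ℂ) (a b c d : ℕ) :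
    coeff (expo a b c d) (σ f) = coeff (expo c d a b) f := by
  classical
  induction f using MvPolynomial.induction_on' with
  | monomial u r =>
    have : σ (monomial u r) = monomial (expo (u 2) (u 3) (u 0) (u 1)) r := by
      rw [expo_self u, monomial_expo, monomial_expo]
      simp only [map_mul, map_pow, h0, h1, h2, h3, algHom_C, algebraMap_eq, ← expo_self]
      ring
    have hu : u = expo c d a b ↔ u 0 = c ∧ u 1 = d ∧ u 2 = a ∧ u 3 = b := by
      conv_lhs => rw [expo_self u, expo_inj]
    rw [this, coeff_monomial, coeff_monomial]
    simp only [expo_inj, hu]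
    congr 1
    apply propext
    tauto
  | add p q hp hq =>
    simp only [map_add, coeff_add, hp, hq]

lemma root_cond (ζ : ℂ) (hζ : IsPrimitiveRoot ζ 6) (a b : ℕ) (h : ζ ^ a * ζ⁻¹ ^ b = 1) :
    a % 6 = b % 6 := by
  have hz : ζ ≠ 0 := hζ.ne_zero (by norm_num)
  have h' : ζ ^ a = ζ ^ b := by
    rw [inv_pow] at h
    field_simp at h
    exact h
  have h6 : orderOf ζ = 6 := hζ.eq_orderOf.symm
  rw [← pow_mod_orderOf ζ a, ← pow_mod_orderOf ζ b, h6] at h'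
  exact hζ.pow_inj (Nat.mod_lt _ (by norm_num)) (Nat.mod_lt _ (by norm_num)) h'

lemma expo_cases (a b c d : ℕ) (q0 : a + b + c + d = 6) (q1 : a % 6 = b % 6)
    (q2 : c % 6 = d % 6) :
    (a = 6 ∧ b = 0 ∧ c = 0 ∧ d = 0) ∨ (a = 0 ∧ b = 6 ∧ c = 0 ∧ d = 0) ∨
        (a = 0 ∧ b = 0 ∧ c = 6 ∧ d = 0) ∨ (a = 0 ∧ b = 0 ∧ c = 0 ∧ d = 6) ∨
        (a = 3 ∧ b = 3 ∧ c = 0 ∧ d = 0) ∨ (a = 0 ∧ b = 0 ∧ c = 3 ∧ d = 3) ∨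
        (a = 2 ∧ b = 2 ∧ c = 1 ∧ d = 1) ∨ (a = 1 ∧ b = 1 ∧ c = 2 ∧ d = 2) := by
  have h1 : a = b ∨ (a = 6 ∧ b = 0) ∨ (a = 0 ∧ b = 6) := by omega
  have h2 : c = d ∨ (c = 6 ∧ d = 0) ∨ (c = 0 ∧ d = 6) := by omega
  rcases h1 with rfl | ⟨rfl, rfl⟩ | ⟨rfl, rfl⟩
  · rcases h2 with rfl | ⟨rfl, rfl⟩ | ⟨rfl, rfl⟩
    · have hc : c = 3 - a := by omega
      have ha : a ≤ 3 := by omega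
      subst hc
      interval_cases a <;> simp
    · have ha : a = 0 := by omega
      simp [ha]
    · have ha : a = 0 := by omega
      simp [ha]
  · have hc : c = 0 := by omega
    have hd : d = 0 := by omega
    simp [hc, hd]
  · have hc : c = 0 := by omega
    have hd : d = 0 := by omega
    simp [hc, hd]

/-- A degree-6 homogeneous `f ∈ ℂ[x₁,y₁,x₂,y₂]` is invariant under `σ₁, σ₂, σ₃`
iff `f = α(x₁⁶+x₂⁶) + β(y₁⁶+y₂⁶) + A·Q₊³ + B·Q₊Q₋²` for some `α, β, A, B ∈ ℂ`,
and these coefficients are uniquely determined. -/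
theorem stmt_10 (ζ : ℂ) (hζ : IsPrimitiveRoot ζ 6)
    (σ₁ σ₂ σ₃ : MvPolynomial (Fin 4) ℂ →ₐ[ℂ] MvPolynomial (Fin 4) ℂ)
    (h₁x₁ : σ₁ (X 0) = C ζ * X 0) (h₁y₁ : σ₁ (X 1) = C ζ⁻¹ * X 1)
    (h₁x₂ : σ₁ (X 2) = X 2) (h₁y₂ : σ₁ (X 3) = X 3)
    (h₂x₁ : σ₂ (X 0) = X 0) (h₂y₁ : σ₂ (X 1) = X 1)
    (h₂x₂ : σ₂ (X 2) = C ζ * X 2) (h₂y₂ : σ₂ (X 3) = C ζ⁻¹ * X 3)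
    (h₃x₁ : σ₃ (X 0) = X 2) (h₃y₁ : σ₃ (X 1) = X 3)
    (h₃x₂ : σ₃ (X 2) = X 0) (h₃y₂ : σ₃ (X 3) = X 1)
    (f : MvPolynomial (Fin 4) ℂ) (hf : f.IsHomogeneous 6) :
    ((σ₁ f = f ∧ σ₂ f = f ∧ σ₃ f = f) ↔
      ∃ α β A B : ℂ, f = sexticForm α β A B) ∧
    (∀ α β A B α' β' A' B' : ℂ,
      sexticForm α β A B = sexticForm α' β' A' B' →
        α = α' ∧ β = β' ∧ A = A' ∧ B = B') := by
  classical
  have hz : ζ ≠ 0 := hζ.ne_zero (by norm_num)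
  refine ⟨⟨?_, ?_⟩, ?_⟩
  · rintro ⟨e1, e2, e3⟩
    have k3 : ∀ a b c d, coeff (expo a b c d) f = coeff (expo c d a b) f := by
      intro a b c d
      conv_lhs => rw [← e3]
      exact coeff_swap σ₃ h₃x₁ h₃y₁ h₃x₂ h₃y₂ f a b c d
    have k1 : ∀ a b c d, coeff (expo a b c d) f ≠ 0 → a % 6 = b % 6 := by
      intro a b c d hne
      have := coeff_diag σ₁ ![ζ, ζ⁻¹, 1, 1]
        (by intro i; fin_cases i <;> simp [h₁x₁, h₁y₁, h₁x₂, h₁y₂]) f a b c d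
      rw [e1] at this
      apply root_cond ζ hζ
      apply mul_right_cancel₀ hne
      simpa using this.symm
    have k2 : ∀ a b c d, coeff (expo a b c d) f ≠ 0 → c % 6 = d % 6 := by
      intro a b c d hne
      rw [k3] at hne
      exact k1 _ _ _ _ hne
    have k0 : ∀ a b c d, coeff (expo a b c d) f ≠ 0 → a + b + c + d = 6 := by
      intro a b c d hne
      have := hf hne
      rw [Finsupp.weight_apply, Finsupp.sum_fintype _ _ (by simp)] at this
      simpa [Fin.sum_univ_four, expo] using this
    refine ⟨coeff (expo 6 0 0 0) f, coeff (expo 0 6 0 0) f,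
      (coeff (expo 3 3 0 0) f + coeff (expo 2 2 1 1) f) / 4,
      (3 * coeff (expo 3 3 0 0) f - coeff (expo 2 2 1 1) f) / 4, ?_⟩
    ext m
    rw [expo_self m]
    generalize m 0 = a, m 1 = b, m 2 = c, m 3 = d
    rw [coeff_sexticForm]
    by_cases hm : (a = 6 ∧ b = 0 ∧ c = 0 ∧ d = 0) ∨ (a = 0 ∧ b = 6 ∧ c = 0 ∧ d = 0) ∨
        (a = 0 ∧ b = 0 ∧ c = 6 ∧ d = 0) ∨ (a = 0 ∧ b = 0 ∧ c = 0 ∧ d = 6) ∨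
        (a = 3 ∧ b = 3 ∧ c = 0 ∧ d = 0) ∨ (a = 0 ∧ b = 0 ∧ c = 3 ∧ d = 3) ∨
        (a = 2 ∧ b = 2 ∧ c = 1 ∧ d = 1) ∨ (a = 1 ∧ b = 1 ∧ c = 2 ∧ d = 2)
    · have s1 := k3 0 0 6 0
      have s2 := k3 0 0 0 6
      have s3 := k3 0 0 3 3
      have s4 := k3 1 1 2 2
      rcases hm with ⟨rfl, rfl, rfl, rfl⟩ | ⟨rfl, rfl, rfl, rfl⟩ | ⟨rfl, rfl, rfl, rfl⟩ |
        ⟨rfl, rfl, rfl, rfl⟩ | ⟨rfl, rfl, rfl, rfl⟩ | ⟨rfl, rfl, rfl, rfl⟩ |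
        ⟨rfl, rfl, rfl, rfl⟩ | ⟨rfl, rfl, rfl, rfl⟩ <;>
        simp [s1, s2, s3, s4] <;> ring
    · have h0 : coeff (expo a b c d) f = 0 := by
        by_contra hne
        exact hm (expo_cases a b c d (k0 _ _ _ _ hne) (k1 _ _ _ _ hne) (k2 _ _ _ _ hne))
      rw [h0,
        if_neg (by rintro ⟨rfl, rfl, rfl, rfl⟩; exact hm (by simp)),
        if_neg (by rintro ⟨rfl, rfl, rfl, rfl⟩; exact hm (by simp)),
        if_neg (by rintro ⟨rfl, rfl, rfl, rfl⟩; exact hm (by simp)),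
        if_neg (by rintro ⟨rfl, rfl, rfl, rfl⟩; exact hm (by simp)),
        if_neg (by rintro ⟨rfl, rfl, rfl, rfl⟩; exact hm (by simp)),
        if_neg (by rintro ⟨rfl, rfl, rfl, rfl⟩; exact hm (by simp)),
        if_neg (by rintro ⟨rfl, rfl, rfl, rfl⟩; exact hm (by simp)),
        if_neg (by rintro ⟨rfl, rfl, rfl, rfl⟩; exact hm (by simp))]
      simp
  · rintro ⟨α, β, A, B, rfl⟩
    have z6 : (C ζ : MvPolynomial (Fin 4) ℂ) ^ 6 = 1 := by
      rw [← C_pow, hζ.pow_eq_one, C_1]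
    have zi6 : (C ζ⁻¹ : MvPolynomial (Fin 4) ℂ) ^ 6 = 1 := by
      rw [← C_pow, inv_pow, hζ.pow_eq_one, inv_one, C_1]
    have zz : (C ζ : MvPolynomial (Fin 4) ℂ) * C ζ⁻¹ = 1 := by
      rw [← C_mul, mul_inv_cancel₀ hz, C_1]
    have zp : ∀ p q : MvPolynomial (Fin 4) ℂ, C ζ * p * (C ζ⁻¹ * q) = p * q := by
      intro p q
      linear_combination p * q * zz
    have zx : ∀ p : MvPolynomial (Fin 4) ℂ, (C ζ * p) ^ 6 = p ^ 6 := by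
      intro p
      rw [mul_pow, z6, one_mul]
    have zy : ∀ p : MvPolynomial (Fin 4) ℂ, (C ζ⁻¹ * p) ^ 6 = p ^ 6 := by
      intro p
      rw [mul_pow, zi6, one_mul]
    refine ⟨?_, ?_, ?_⟩
    · simp only [sexticForm, map_add, map_sub, map_mul, map_pow, algHom_C, algebraMap_eq,
        h₁x₁, h₁x₂, h₁y₁, h₁y₂, zp, zx, zy]
    · simp only [sexticForm, map_add, map_sub, map_mul, map_pow, algHom_C, algebraMap_eq,
        h₂x₁, h₂x₂, h₂y₁, h₂y₂, zp, zx, zy]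
    · simp only [sexticForm, map_add, map_sub, map_mul, map_pow, algHom_C, algebraMap_eq,
        h₃x₁, h₃x₂, h₃y₁, h₃y₂]
      ring
  · intro α β A B α' β' A' B' h
    have c1 := congrArg (coeff (expo 6 0 0 0)) h
    have c2 := congrArg (coeff (expo 0 6 0 0)) h
    have c3 := congrArg (coeff (expo 3 3 0 0)) h
    have c4 := congrArg (coeff (expo 2 2 1 1)) h
    simp [coeff_sexticForm] at c1 c2 c3 c4
    refine ⟨c1, c2, ?_, ?_⟩
    · linear_combination (c3 + c4) / 4
    · linear_combination (3 * c3 - c4) / 4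
end

section
/- The complex vector space of alternating bilinear forms ω on ℂ⁴ satisfying ω(g·v, g·w) = ω(v, w) for all g ∈ G and all v, w ∈ ℂ⁴ is one-dimensional, spanned by the standard symplectic form ω₀ determined by ω₀(e₁,e₂) = 1, ω₀(e₃,e₄) = 1, and ω₀(e₁,e₃) = ω₀(e₁,e₄) = ω₀(e₂,e₃) = ω₀(e₂,e₄) = 0, where e₁, e₂, e₃, e₄ is the standard basis of ℂ⁴. -/
/-- The space of alternating bilinear forms on `ℂ⁴` invariant under the group `G`
generated by `g₁ = diag(ζ, ζ⁻¹, 1, 1)`, `g₂ = diag(1, 1, ζ, ζ⁻¹)` and the swap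
`e₁ ↔ e₃, e₂ ↔ e₄` is one-dimensional, spanned by the standard symplectic form
`ω₀ (v, w) = v₁w₂ - v₂w₁ + v₃w₄ - v₄w₃`: a bilinear form `ω` is alternating and
`G`-invariant iff `ω = c·ω₀` for a (unique) scalar `c`. -/
theorem stmt_12 (ζ : ℂ) (hζ : IsPrimitiveRoot ζ 6)
    (g₁ g₂ g₃ : GL (Fin 4) ℂ)
    (hg₁ : (g₁ : Matrix (Fin 4) (Fin 4) ℂ) = Matrix.diagonal ![ζ, ζ⁻¹, 1, 1])
    (hg₂ : (g₂ : Matrix (Fin 4) (Fin 4) ℂ) = Matrix.diagonal ![1, 1, ζ, ζ⁻¹])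
    (hg₃ : (g₃ : Matrix (Fin 4) (Fin 4) ℂ) =
      !![0, 0, 1, 0; 0, 0, 0, 1; 1, 0, 0, 0; 0, 1, 0, 0])
    (ω : (Fin 4 → ℂ) →ₗ[ℂ] (Fin 4 → ℂ) →ₗ[ℂ] ℂ) :
    ((∀ v : Fin 4 → ℂ, ω v v = 0) ∧
      ∀ g ∈ Subgroup.closure ({g₁, g₂, g₃} : Set (GL (Fin 4) ℂ)),
        ∀ v w : Fin 4 → ℂ,
          ω ((g : Matrix (Fin 4) (Fin 4) ℂ).mulVec v)
            ((g : Matrix (Fin 4) (Fin 4) ℂ).mulVec w) = ω v w) ↔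
    ∃! c : ℂ, ∀ v w : Fin 4 → ℂ,
      ω v w = c * (v 0 * w 1 - v 1 * w 0 + v 2 * w 3 - v 3 * w 2) := by
  have hz0 : ζ ≠ 0 := hζ.ne_zero (by norm_num)
  have hz1 : ζ ≠ 1 := hζ.ne_one (by norm_num)
  have hzi : ζ⁻¹ ≠ 1 := by simpa using hz1
  have hzz : ζ * ζ⁻¹ = 1 := mul_inv_cancel₀ hz0
  have hexp : ∀ v w : Fin 4 → ℂ, ω v w =
      ∑ i, ∑ j, v i * (w j * ω (Pi.single i 1) (Pi.single j 1)) := by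
    intro v w
    conv_lhs => rw [pi_eq_sum_univ' v, pi_eq_sum_univ' w]
    simp only [map_sum, map_smul, LinearMap.sum_apply, LinearMap.smul_apply, smul_eq_mul,
      Finset.mul_sum]
    rw [Finset.sum_comm]
    exact Finset.sum_congr rfl fun i _ => Finset.sum_congr rfl fun j _ => by ring
  constructor
  · rintro ⟨halt, hinv⟩
    have hswap : ∀ v w, ω v w = - ω w v := by
      intro v w
      have h := halt (v + w)
      simp only [map_add, LinearMap.add_apply, halt] at h
      linear_combination h
    have h1 := hinv g₁ (Subgroup.subset_closure (by simp))
    have h3 := hinv g₃ (Subgroup.subset_closure (by simp))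
    have hd : ∀ i j : Fin 4, ![ζ, ζ⁻¹, 1, 1] i * (![ζ, ζ⁻¹, 1, 1] j *
        ω (Pi.single i 1) (Pi.single j 1)) = ω (Pi.single i 1) (Pi.single j 1) := by
      intro i j
      have hs : ∀ k : Fin 4, (Matrix.diagonal ![ζ, ζ⁻¹, 1, 1]).mulVec (Pi.single k 1) =
          ![ζ, ζ⁻¹, 1, 1] k • (Pi.single k 1 : Fin 4 → ℂ) := by
        intro k
        ext l
        rw [Matrix.mulVec_diagonal]
        by_cases hkl : l = k
        · subst hkl; simp
        · simp [hkl]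
      have h := h1 (Pi.single i 1) (Pi.single j 1)
      rw [hg₁, hs, hs] at h
      simp only [map_smul, LinearMap.smul_apply, smul_eq_mul] at h
      rw [mul_left_comm]
      exact h
    have key : ∀ z a : ℂ, z ≠ 1 → z * a = a → a = 0 := by
      intro z a hz h
      have : (z - 1) * a = 0 := by linear_combination h
      exact (mul_eq_zero.mp this).resolve_left (sub_ne_zero.mpr hz)
    have a02 := key _ _ hz1 (by simpa using hd 0 2)
    have a03 := key _ _ hz1 (by simpa using hd 0 3)
    have a12 := key _ _ hzi (by simpa using hd 1 2)
    have a13 := key _ _ hzi (by simpa using hd 1 3)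
    have a23 : ω (Pi.single 2 1) (Pi.single 3 1) = ω (Pi.single 0 1) (Pi.single 1 1) := by
      have h := h3 (Pi.single 0 1) (Pi.single 1 1)
      rw [hg₃] at h
      rw [← h]
      congr 2
      · congr 1
        ext l; fin_cases l <;> simp
      · ext l; fin_cases l <;> simp
    refine ⟨ω (Pi.single 0 1) (Pi.single 1 1), ?_, ?_⟩
    · intro v w
      rw [hexp]
      simp only [Fin.sum_univ_four, halt, a02, a03, a12, a13, a23,
        hswap (Pi.single 1 1) (Pi.single 0 1), hswap (Pi.single 2 1) (Pi.single 0 1),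
        hswap (Pi.single 3 1) (Pi.single 0 1), hswap (Pi.single 2 1) (Pi.single 1 1),
        hswap (Pi.single 3 1) (Pi.single 1 1), hswap (Pi.single 3 1) (Pi.single 2 1)]
      ring
    · intro c hc
      have := hc (Pi.single 0 1) (Pi.single 1 1)
      simpa using this.symm
  · rintro ⟨c, hc, -⟩
    refine ⟨fun v => by rw [hc]; ring, ?_⟩
    intro g hg
    induction hg using Subgroup.closure_induction with
    | mem x hx =>
      intro v w
      rw [hc, hc]
      rcases hx with rfl | rfl | rfl
      · rw [hg₁]
        simp only [Matrix.mulVec_diagonal]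
        simp
        left
        linear_combination (v 0 * w 1 - v 1 * w 0) * hzz
      · rw [hg₂]
        simp only [Matrix.mulVec_diagonal]
        simp
        left
        linear_combination (v 2 * w 3 - v 3 * w 2) * hzz
      · rw [hg₃]
        simp [Matrix.mulVec, dotProduct, Fin.sum_univ_four]
        left
        ring
    | one => intro v w; simp
    | mul x y _ _ hx hy =>
      intro v w
      rw [Units.val_mul, ← Matrix.mulVec_mulVec, ← Matrix.mulVec_mulVec, hx, hy]
    | inv x _ hx =>
      intro v w
      rw [← hx, Matrix.mulVec_mulVec, Matrix.mulVec_mulVec, Units.mul_inv, Matrix.one_mulVec,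
        Matrix.one_mulVec]
end
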